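/- For the 3-uniform patterns P_k one has λ(P_1) = 1/√3 and, for every integer k ≥ 1, λ(P_{k+1}) = 1/√(3 − 2·λ(P_k)). Consequently λ(P_k) = μ_k for every k ≥ 1, where μ_1 = 1/√3 and μ_{k+1} = 1/√(3 − 2μ_k). -/

import Mathlib

/-- The Lagrange polynomial of a family `E` of `r`-element multisets on `{1, …, m}`:
`λ_E(x) = r! · Σ_{S ∈ E} Π_{i=1}^m x_i^{S(i)} / S(i)!`. -/
noncomputable def lagrangePoly (r m : ℕ) (E : Finset (Multiset ℕ)) (x : ℕ → ℝ) : ℝ :=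
  (Nat.factorial r : ℝ) *
    ∑ S ∈ E, ∏ i ∈ Finset.Icc 1 m, x i ^ (S.count i) / (Nat.factorial (S.count i) : ℝ)

/-- The standard simplex `Δ_{m-1}`, viewed on the coordinates `1, …, m`. -/
def patternSimplex (m : ℕ) : Set (ℕ → ℝ) :=
  {x | (∀ i ∈ Finset.Icc 1 m, 0 ≤ x i ∧ x i ≤ 1) ∧ ∑ i ∈ Finset.Icc 1 m, x i = 1}

/-- The Lagrangian `λ(P)` of the pattern `P = (m, E)` (with uniformity `r`):
the supremum (in fact maximum) of the Lagrange polynomial over the standard simplex. -/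
noncomputable def lagrangian (r m : ℕ) (E : Finset (Multiset ℕ)) : ℝ :=
  sSup (lagrangePoly r m E '' patternSimplex m)

/-- A vector is `P`-optimal if it lies in the simplex and attains the Lagrangian. -/
def IsOptimalVec (r m : ℕ) (E : Finset (Multiset ℕ)) (x : ℕ → ℝ) : Prop :=
  x ∈ patternSimplex m ∧ lagrangePoly r m E x = lagrangian r m E

/-- A pattern is minimal if no `P`-optimal vector has a zero entry. -/
def IsMinimalPattern (r m : ℕ) (E : Finset (Multiset ℕ)) : Prop :=
  ∀ x : ℕ → ℝ, IsOptimalVec r m E x → ∀ i ∈ Finset.Icc 1 m, x i ≠ 0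

/-- One step of the recursive construction: given the edge family of `P_k`
(on `{1, …, m-2}`), produce the edge family of `P_{k+1}` on `{1, …, m}`:
all multisets `{1,2,a}` with `3 ≤ a ≤ m`, all multisets `{1,a,b}` and `{2,a,b}` with
`3 ≤ a ≤ b ≤ m`, together with every multiset of the old family shifted up by `2`. -/
def stepE (m : ℕ) (old : Finset (Multiset ℕ)) : Finset (Multiset ℕ) :=
  ((Finset.Icc 3 m).image fun a => ({1, 2, a} : Multiset ℕ)) ∪
  ((Finset.Icc 3 m ×ˢ Finset.Icc 3 m).image fun p => ({1, p.1, p.2} : Multiset ℕ)) ∪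
  ((Finset.Icc 3 m ×ˢ Finset.Icc 3 m).image fun p => ({2, p.1, p.2} : Multiset ℕ)) ∪
  old.image (Multiset.map (· + 2))

/-- `patE k` is the edge family `E_{k+1}` of the 3-uniform pattern
`P_{k+1} = (2(k+1)+1, E_{k+1})`, so that `patE 0 = E_1 = {{1,2,3},{1,3,3},{2,3,3}}`
on `{1,2,3}`, and `patE (k+1)` on `{1, …, 2k+5}` is obtained from `patE k` by `stepE`. -/
def patE : ℕ → Finset (Multiset ℕ)
  | 0 => {({1, 2, 3} : Multiset ℕ), ({1, 3, 3} : Multiset ℕ), ({2, 3, 3} : Multiset ℕ)}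
  | k + 1 => stepE (2 * (k + 1) + 3) (patE k)

/-- The sequence `μ_k`: `μ_1 = 1/√3` and `μ_{k+1} = 1/√(3 - 2 μ_k)`
(the value `μ_0 = 0` is a junk value making the recursion total). -/
noncomputable def mu : ℕ → ℝ
  | 0 => 0
  | k + 1 => 1 / Real.sqrt (3 - 2 * mu k)

section

open Finset

/-- The normalized monomial `Π x_i^{S(i)} / S(i)!` of a multiset `S`. -/
noncomputable def multisetMonomial (x : ℕ → ℝ) (S : Multiset ℕ) : ℝ :=
  ∏ i ∈ S.toFinset, x i ^ S.count i / (Nat.factorial (S.count i) : ℝ)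

theorem multisetMonomial_eq_prod (x : ℕ → ℝ) {S : Multiset ℕ} {s : Finset ℕ}
    (h : ∀ i ∈ S, i ∈ s) :
    multisetMonomial x S = ∏ i ∈ s, x i ^ S.count i / (Nat.factorial (S.count i) : ℝ) := by
  refine prod_subset (fun i hi => h i (by simpa using hi)) fun i _ hi => ?_
  have : S.count i = 0 := Multiset.count_eq_zero.2 (by simpa using hi)
  simp [this]

theorem multisetMonomial_cons (x : ℕ → ℝ) {a : ℕ} {S : Multiset ℕ} (h : a ∉ S) :
    multisetMonomial x (a ::ₘ S) = x a * multisetMonomial x S := by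
  rw [multisetMonomial, Multiset.toFinset_cons, prod_insert (by simpa using h)]
  congr 1
  · simp [Multiset.count_eq_zero.2 h]
  · refine prod_congr rfl fun i hi => ?_
    have : i ≠ a := by rintro rfl; exact h (by simpa using hi)
    rw [Multiset.count_cons_of_ne this]

theorem multisetMonomial_singleton (x : ℕ → ℝ) (a : ℕ) : multisetMonomial x {a} = x a := by
  simp [multisetMonomial]

theorem multisetMonomial_pair_self (x : ℕ → ℝ) (a : ℕ) :
    multisetMonomial x {a, a} = x a ^ 2 / 2 := by
  simp [multisetMonomial]

theorem multisetMonomial_pair (x : ℕ → ℝ) {a b : ℕ} (h : a ≠ b) :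
    multisetMonomial x {a, b} = x a * x b := by
  rw [Multiset.insert_eq_cons, multisetMonomial_cons x (by simpa using h),
    multisetMonomial_singleton]

theorem multisetMonomial_map_add (x : ℕ → ℝ) (c : ℕ) (S : Multiset ℕ) :
    multisetMonomial x (S.map (· + c)) = multisetMonomial (fun i => x (i + c)) S := by
  rw [multisetMonomial, Multiset.toFinset_map, prod_image (by simp)]
  refine prod_congr rfl fun i _ => ?_
  rw [Multiset.count_map_eq_count' (· + c) S (add_left_injective c)]

theorem multisetMonomial_const_mul (c : ℝ) (x : ℕ → ℝ) (S : Multiset ℕ) :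
    multisetMonomial (fun i => c * x i) S = c ^ S.card * multisetMonomial x S := by
  simp only [multisetMonomial]
  rw [← Multiset.toFinset_sum_count_eq, ← prod_pow_eq_pow_sum, ← prod_mul_distrib]
  exact prod_congr rfl fun i _ => by rw [mul_pow, mul_div_assoc]

theorem lagrangePoly_eq_sum {r m : ℕ} {E : Finset (Multiset ℕ)}
    (h : ∀ S ∈ E, ∀ i ∈ S, i ∈ Icc 1 m) (x : ℕ → ℝ) :
    lagrangePoly r m E x = (Nat.factorial r : ℝ) * ∑ S ∈ E, multisetMonomial x S := by
  rw [lagrangePoly]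
  congr 1
  exact sum_congr rfl fun S hS => (multisetMonomial_eq_prod x (h S hS)).symm

theorem lagrangePoly_const_mul {r m : ℕ} {E : Finset (Multiset ℕ)}
    (h : ∀ S ∈ E, ∀ i ∈ S, i ∈ Icc 1 m) (hr : ∀ S ∈ E, S.card = r) (c : ℝ) (x : ℕ → ℝ) :
    lagrangePoly r m E (fun i => c * x i) = c ^ r * lagrangePoly r m E x := by
  rw [lagrangePoly_eq_sum h, lagrangePoly_eq_sum h, mul_left_comm, mul_sum E _ (c ^ r)]
  congr 1
  exact sum_congr rfl fun S hS => by rw [multisetMonomial_const_mul, hr S hS]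

theorem pair_eq_pair_iff {a b c d : ℕ} :
    ({a, b} : Multiset ℕ) = {c, d} ↔ a = c ∧ b = d ∨ a = d ∧ b = c := by
  simp only [Multiset.insert_eq_cons, Multiset.cons_eq_cons, Multiset.singleton_inj]
  constructor
  · rintro (h | ⟨_, t, h1, h2⟩)
    · exact Or.inl h
    · have ht : t = 0 := by simpa using congrArg Multiset.card h1
      subst ht
      simp at h1 h2
      exact Or.inr ⟨h2.symm, h1⟩
  · rintro (h | ⟨rfl, rfl⟩)
    · exact Or.inl h
    · by_cases hab : a = b
      · exact Or.inl ⟨hab, hab.symm⟩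
      · exact Or.inr ⟨hab, 0, by simp, by simp⟩

theorem sum_multisetMonomial_pairs (x : ℕ → ℝ) (s : Finset ℕ) :
    ∑ S ∈ (s ×ˢ s).image (fun p => ({p.1, p.2} : Multiset ℕ)), multisetMonomial x S
      = (∑ i ∈ s, x i) ^ 2 / 2 := by
  induction s using Finset.induction_on with
  | empty => simp
  | insert a s ha ih =>
    have hsplit : ((insert a s) ×ˢ (insert a s)).image (fun p => ({p.1, p.2} : Multiset ℕ))
        = (s ×ˢ s).image (fun p => ({p.1, p.2} : Multiset ℕ))
          ∪ (insert a s).image fun b => ({a, b} : Multiset ℕ) := by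
      ext S
      simp only [mem_image, mem_union, mem_product, mem_insert, Prod.exists]
      constructor
      · rintro ⟨b, c, ⟨rfl | hb, rfl | hc⟩, rfl⟩
        · exact Or.inr ⟨_, Or.inl rfl, rfl⟩
        · exact Or.inr ⟨c, Or.inr hc, rfl⟩
        · exact Or.inr ⟨b, Or.inr hb, Multiset.pair_comm _ _⟩
        · exact Or.inl ⟨b, c, ⟨hb, hc⟩, rfl⟩
      · rintro (⟨b, c, ⟨hb, hc⟩, rfl⟩ | ⟨b, hb, rfl⟩)
        · exact ⟨b, c, ⟨Or.inr hb, Or.inr hc⟩, rfl⟩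
        · exact ⟨a, b, ⟨Or.inl rfl, hb⟩, rfl⟩
    have hdisj : Disjoint ((s ×ˢ s).image (fun p => ({p.1, p.2} : Multiset ℕ)))
        ((insert a s).image fun b => ({a, b} : Multiset ℕ)) := by
      simp only [disjoint_left, mem_image, mem_product, Prod.exists]
      rintro _ ⟨b, c, ⟨hb, hc⟩, rfl⟩ ⟨d, _, h⟩
      rcases pair_eq_pair_iff.1 h with ⟨rfl, _⟩ | ⟨rfl, _⟩
      exacts [ha hb, ha hc]
    have hinj : Set.InjOn (fun b => ({a, b} : Multiset ℕ)) (insert a s : Finset ℕ) := by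
      intro b _ c _ h
      rcases pair_eq_pair_iff.1 h with ⟨_, h⟩ | ⟨h, h'⟩
      exacts [h, h'.trans h]
    rw [hsplit, sum_union hdisj, ih, sum_image hinj, sum_insert ha, sum_insert ha,
      multisetMonomial_pair_self,
      sum_congr rfl fun b (hb : b ∈ s) =>
        multisetMonomial_pair x (ne_of_mem_of_not_mem hb ha).symm, ← mul_sum]
    ring

theorem sum_multisetMonomial_image_cons (x : ℕ → ℝ) (a : ℕ) {F : Finset (Multiset ℕ)}
    (h : ∀ S ∈ F, a ∉ S) :
    ∑ S ∈ F.image (Multiset.cons a), multisetMonomial x S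
      = x a * ∑ S ∈ F, multisetMonomial x S := by
  rw [sum_image (fun S _ T _ h => (Multiset.cons_inj_right a).1 h), mul_sum]
  exact sum_congr rfl fun S hS => multisetMonomial_cons x (h S hS)

theorem sum_multisetMonomial_cons_pairs (x : ℕ → ℝ) (a : ℕ) {s : Finset ℕ} (ha : a ∉ s) :
    ∑ S ∈ (s ×ˢ s).image (fun p => ({a, p.1, p.2} : Multiset ℕ)), multisetMonomial x S
      = x a * ((∑ i ∈ s, x i) ^ 2 / 2) := by
  rw [← sum_multisetMonomial_pairs, ← sum_multisetMonomial_image_cons, image_image]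
  · rfl
  · simp only [mem_image, mem_product, Prod.exists]
    rintro _ ⟨b, c, ⟨hb, hc⟩, rfl⟩ h
    simp only [Multiset.insert_eq_cons, Multiset.mem_cons, Multiset.mem_singleton] at h
    rcases h with rfl | rfl
    exacts [ha hb, ha hc]

theorem mem_stepE {m : ℕ} {E : Finset (Multiset ℕ)} {S : Multiset ℕ} :
    S ∈ stepE m E ↔ (∃ a ∈ Icc 3 m, {1, 2, a} = S) ∨
      (∃ a ∈ Icc 3 m, ∃ b ∈ Icc 3 m, {1, a, b} = S) ∨
      (∃ a ∈ Icc 3 m, ∃ b ∈ Icc 3 m, {2, a, b} = S) ∨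
      ∃ T ∈ E, T.map (· + 2) = S := by
  simp only [stepE, mem_union, mem_image, mem_product, Prod.exists, or_assoc, and_assoc,
    exists_and_left]

/-- `E` consists of `3`-element multisets on `{1, …, m}`. -/
def IsThreeUniformOn (m : ℕ) (E : Finset (Multiset ℕ)) : Prop :=
  ∀ S ∈ E, S.card = 3 ∧ ∀ i ∈ S, i ∈ Icc 1 m

theorem IsThreeUniformOn.stepE {m : ℕ} {E : Finset (Multiset ℕ)} (h : IsThreeUniformOn m E) :
    IsThreeUniformOn (m + 2) (stepE (m + 2) E) := by
  intro S hS
  rcases mem_stepE.1 hS with ⟨a, ha, rfl⟩ | ⟨a, ha, b, hb, rfl⟩ | ⟨a, ha, b, hb, rfl⟩ |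
    ⟨T, hT, rfl⟩
  · refine ⟨rfl, fun i hi => ?_⟩
    simp at hi ha ⊢
    omega
  · refine ⟨rfl, fun i hi => ?_⟩
    simp at hi ha hb ⊢
    omega
  · refine ⟨rfl, fun i hi => ?_⟩
    simp at hi ha hb ⊢
    omega
  · refine ⟨by simpa using (h T hT).1, fun i hi => ?_⟩
    obtain ⟨j, hj, rfl⟩ := Multiset.mem_map.1 hi
    have := (h T hT).2 j hj
    simp at this ⊢
    omega

theorem sum_Icc_three_eq (m : ℕ) (x : ℕ → ℝ) :
    ∑ i ∈ Icc 3 (m + 2), x i = ∑ i ∈ Icc 1 m, x (i + 2) := by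
  rw [← sum_image (f := x) (g := (· + 2)) (by simp), image_add_right_Icc]

theorem sum_Icc_one_add_two (m : ℕ) (x : ℕ → ℝ) :
    ∑ i ∈ Icc 1 (m + 2), x i = x 1 + x 2 + ∑ i ∈ Icc 1 m, x (i + 2) := by
  have : Icc 1 (m + 2) = insert 1 (insert 2 (Icc 3 (m + 2))) := by
    ext i; simp; omega
  rw [this, sum_insert (by simp), sum_insert (by simp), sum_Icc_three_eq, add_assoc]

theorem lagrangePoly_stepE {m : ℕ} {E : Finset (Multiset ℕ)} (h : IsThreeUniformOn m E)
    (x : ℕ → ℝ) :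
    lagrangePoly 3 (m + 2) (stepE (m + 2) E) x
      = 6 * x 1 * x 2 * ∑ i ∈ Icc 1 m, x (i + 2)
        + 3 * (x 1 + x 2) * (∑ i ∈ Icc 1 m, x (i + 2)) ^ 2
        + lagrangePoly 3 m E fun i => x (i + 2) := by
  rw [lagrangePoly_eq_sum fun S hS => (h.stepE S hS).2,
    lagrangePoly_eq_sum fun S hS => (h S hS).2]
  have hold : ∀ T ∈ E, ∀ i ∈ T.map (· + 2), 3 ≤ i := by
    intro T hT i hi
    obtain ⟨j, hj, rfl⟩ := Multiset.mem_map.1 hi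
    have := mem_Icc.1 ((h T hT).2 j hj)
    omega
  rw [stepE, sum_union, sum_union, sum_union, sum_multisetMonomial_cons_pairs x 1 (by simp),
    sum_multisetMonomial_cons_pairs x 2 (by simp),
    sum_image (fun S _ T _ h => Multiset.map_injective (add_left_injective 2) h)]
  · simp only [multisetMonomial_map_add]
    rw [sum_image, sum_congr rfl fun a ha => (?_ : multisetMonomial x {1, 2, a}
      = x 1 * x 2 * x a), ← mul_sum, sum_Icc_three_eq]
    · simp [Nat.factorial]
      ring
    · have ha := (mem_Icc.1 ha).1
      rw [Multiset.insert_eq_cons, multisetMonomial_cons, multisetMonomial_pair x (by omega),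
        mul_assoc]
      simp
      omega
    · intro a _ b _ hab
      simpa using hab
  · simp only [disjoint_left, mem_image, mem_product, Prod.exists]
    rintro _ ⟨a, ha, rfl⟩ ⟨b, c, ⟨hb, hc⟩, h'⟩
    have : 2 ∈ ({1, b, c} : Multiset ℕ) := h' ▸ by simp
    simp at this hb hc
    omega
  · simp only [disjoint_left, mem_union, mem_image, mem_product, Prod.exists]
    rintro _ (⟨a, ha, rfl⟩ | ⟨a, a', ha, rfl⟩) ⟨b, c, ⟨hb, hc⟩, h'⟩
    all_goals
      have : 1 ∈ ({2, b, c} : Multiset ℕ) := h' ▸ by simp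
      simp at this hb hc
      omega
  · simp only [disjoint_left, mem_union, mem_image, mem_product, Prod.exists]
    rintro _ h1 ⟨T, hT, rfl⟩
    rcases h1 with (⟨a, ha, h'⟩ | ⟨a, a', ha, h'⟩) | ⟨a, a', ha, h'⟩
    · have := hold T hT 1 (h' ▸ by simp)
      omega
    · have := hold T hT 1 (h' ▸ by simp)
      omega
    · have := hold T hT 2 (h' ▸ by simp)
      omega

theorem mem_patternSimplex_iff {m : ℕ} {x : ℕ → ℝ} :
    x ∈ patternSimplex m ↔ (∀ i ∈ Icc 1 m, 0 ≤ x i) ∧ ∑ i ∈ Icc 1 m, x i = 1 :=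
  ⟨fun h => ⟨fun i hi => (h.1 i hi).1, h.2⟩, fun h => ⟨fun i hi =>
    ⟨h.1 i hi, h.2 ▸ single_le_sum h.1 hi⟩, h.2⟩⟩

theorem lagrangePoly_le_mul_sum_pow {m : ℕ} {E : Finset (Multiset ℕ)} {L : ℝ}
    (h : IsThreeUniformOn m E) (hL : L ∈ upperBounds (lagrangePoly 3 m E '' patternSimplex m))
    {x : ℕ → ℝ} (hx : ∀ i ∈ Icc 1 m, 0 ≤ x i) :
    lagrangePoly 3 m E x ≤ L * (∑ i ∈ Icc 1 m, x i) ^ 3 := by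
  set t := ∑ i ∈ Icc 1 m, x i with ht
  have hE : ∀ S ∈ E, ∀ i ∈ S, i ∈ Icc 1 m := fun S hS => (h S hS).2
  have hcard : ∀ S ∈ E, S.card = 3 := fun S hS => (h S hS).1
  rcases (sum_nonneg hx).eq_or_lt with h0 | hpos
  · have hx0 := (sum_eq_zero_iff_of_nonneg hx).1 h0.symm
    have : lagrangePoly 3 m E x = lagrangePoly 3 m E fun i => 0 * x i := by
      simp only [lagrangePoly]
      congr 1
      refine sum_congr rfl fun S _ => prod_congr rfl fun i hi => ?_
      rw [hx0 i hi, mul_zero]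
    rw [this, lagrangePoly_const_mul hE hcard, ht, ← h0]
    simp
  · have hmem : (fun i => t⁻¹ * x i) ∈ patternSimplex m := by
      refine mem_patternSimplex_iff.2 ⟨fun i hi => ?_, ?_⟩
      · exact mul_nonneg (inv_nonneg.2 hpos.le) (hx i hi)
      · rw [← mul_sum]
        exact inv_mul_cancel₀ hpos.ne'
    have hle := hL ⟨_, hmem, rfl⟩
    rw [lagrangePoly_const_mul hE hcard, inv_pow, inv_mul_le_iff₀ (pow_pos hpos 3)] at hle
    linarith

theorem isGreatest_lagrangePoly_stepE {m : ℕ} {E : Finset (Multiset ℕ)} {L : ℝ}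
    (h : IsThreeUniformOn m E) (hL : IsGreatest (lagrangePoly 3 m E '' patternSimplex m) L)
    (hL1 : L < 1) :
    IsGreatest (lagrangePoly 3 (m + 2) (stepE (m + 2) E) '' patternSimplex (m + 2))
      (1 / Real.sqrt (3 - 2 * L)) := by
  set s := 1 / Real.sqrt (3 - 2 * L) with hs
  have hroot : 1 < Real.sqrt (3 - 2 * L) := by
    rw [Real.lt_sqrt zero_le_one]; linarith
  have hspos : 0 < s := by positivity
  have hs1 : s < 1 := by
    rw [hs, div_lt_one (by positivity)]; exact hroot
  have hsq : s ^ 2 * (3 - 2 * L) = 1 := by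
    rw [hs, div_pow, Real.sq_sqrt (by linarith)]
    field_simp [show (3 - 2 * L) ≠ 0 by linarith]
  constructor
  · obtain ⟨y, hy, rfl⟩ := hL.1
    have hy' := mem_patternSimplex_iff.1 hy
    let x : ℕ → ℝ := fun i => if i ≤ 2 then (1 - s) / 2 else s * y (i - 2)
    have hx1 : x 1 = (1 - s) / 2 := by simp [x]
    have hx2 : x 2 = (1 - s) / 2 := by simp [x]
    have hsum : ∑ i ∈ Icc 1 m, x (i + 2) = s := by
      rw [sum_congr rfl fun i hi => (?_ : x (i + 2) = s * y i), ← mul_sum, hy'.2, mul_one]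
      have := mem_Icc.1 hi
      simp [x]
      omega
    have hshift : (lagrangePoly 3 m E fun i => x (i + 2))
        = s ^ 3 * lagrangePoly 3 m E y := by
      rw [← lagrangePoly_const_mul (fun S hS => (h S hS).2) fun S hS => (h S hS).1]
      simp only [lagrangePoly]
      congr 1
      refine sum_congr rfl fun S _ => prod_congr rfl fun i hi => ?_
      have hi0 : i ≠ 0 := by have := mem_Icc.1 hi; omega
      simp [x, hi0]
    refine ⟨x, mem_patternSimplex_iff.2 ⟨fun i hi => ?_, ?_⟩, ?_⟩
    · by_cases hi2 : i ≤ 2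
      · simp only [x, hi2, if_true]
        linarith
      · simp only [x, hi2, if_false]
        refine mul_nonneg hspos.le (hy'.1 _ ?_)
        simp at hi ⊢
        omega
    · rw [sum_Icc_one_add_two, hx1, hx2, hsum]
      ring
    · rw [lagrangePoly_stepE h, hx1, hx2, hsum, hshift]
      linear_combination (-s / 2) * hsq
  · rintro _ ⟨x, hx, rfl⟩
    obtain ⟨hx0, hx1⟩ := mem_patternSimplex_iff.1 hx
    rw [sum_Icc_one_add_two] at hx1
    have hnonneg : ∀ i ∈ Icc 1 m, 0 ≤ x (i + 2) := fun i hi => hx0 _ (by simp at hi ⊢; omega)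
    have hle := lagrangePoly_le_mul_sum_pow h hL.2 hnonneg
    have ht0 := sum_nonneg hnonneg
    rw [lagrangePoly_stepE h]
    set t := ∑ i ∈ Icc 1 m, x (i + 2)
    have hsum : x 1 + x 2 = 1 - t := by linarith
    have hamgm : 6 * x 1 * x 2 * t ≤ 3 / 2 * (1 - t) ^ 2 * t := by
      rw [← hsum]
      nlinarith [mul_nonneg (sq_nonneg (x 1 - x 2)) ht0]
    have hcubic : 3 / 2 * t - (3 - 2 * L) / 2 * t ^ 3 ≤ s := by
      have h1 : 0 ≤ (s - t) ^ 2 * (2 * s + t) := by positivity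
      have h2 : 0 ≤ (3 - 2 * L) * ((s - t) ^ 2 * (2 * s + t)) :=
        mul_nonneg (by linarith) h1
      have h3 : (3 - 2 * L) * ((s - t) ^ 2 * (2 * s + t))
          = 2 * s - 3 * t + (3 - 2 * L) * t ^ 3 := by
        linear_combination (2 * s - 3 * t) * hsq
      linarith
    rw [hsum]
    linarith

theorem one_div_sqrt_lt_one {L : ℝ} (hL : L < 1) : 1 / Real.sqrt (3 - 2 * L) < 1 := by
  have : 1 < Real.sqrt (3 - 2 * L) := by
    rw [Real.lt_sqrt zero_le_one]; linarith
  rw [div_lt_one (by linarith)]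
  exact this

theorem mu_lt_one (k : ℕ) : mu k < 1 := by
  induction k with
  | zero => simp [mu]
  | succ k ih => exact one_div_sqrt_lt_one ih

theorem patE_zero_eq_stepE : patE 0 = stepE 3 ∅ := by
  decide

theorem isThreeUniformOn_patE (k : ℕ) : IsThreeUniformOn (2 * k + 3) (patE k) := by
  induction k with
  | zero =>
    rw [patE_zero_eq_stepE]
    exact IsThreeUniformOn.stepE (m := 1) (by simp [IsThreeUniformOn])
  | succ k ih => exact ih.stepE

theorem isGreatest_lagrangePoly_patE (k : ℕ) :
    IsGreatest (lagrangePoly 3 (2 * k + 3) (patE k) '' patternSimplex (2 * k + 3))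
      (mu (k + 1)) := by
  induction k with
  | zero =>
    rw [patE_zero_eq_stepE]
    refine isGreatest_lagrangePoly_stepE (m := 1) (by simp [IsThreeUniformOn]) ⟨?_, ?_⟩
      (mu_lt_one 0)
    · exact ⟨fun _ => 1, by simp [patternSimplex], by simp [lagrangePoly, mu]⟩
    · rintro _ ⟨x, _, rfl⟩
      simp [lagrangePoly, mu]
  | succ k ih =>
    exact isGreatest_lagrangePoly_stepE (isThreeUniformOn_patE k) ih (mu_lt_one _)

end

/-- `λ(P_1) = 1/√3`, and for every `k ≥ 1`, `λ(P_{k+1}) = 1/√(3 - 2 λ(P_k))`;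
consequently `λ(P_k) = μ_k` for every `k ≥ 1` (here `patE k` is the edge family of
`P_{k+1}`, a 3-uniform pattern on `{1, …, 2(k+1)+1}`). -/
theorem lagrangian_patE :
    lagrangian 3 3 (patE 0) = 1 / Real.sqrt 3 ∧
    (∀ k : ℕ, lagrangian 3 (2 * (k + 1) + 3) (patE (k + 1))
      = 1 / Real.sqrt (3 - 2 * lagrangian 3 (2 * k + 3) (patE k))) ∧
    (∀ k : ℕ, lagrangian 3 (2 * k + 3) (patE k) = mu (k + 1)) := by
  have hmu : ∀ k : ℕ, lagrangian 3 (2 * k + 3) (patE k) = mu (k + 1) :=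
    fun k => (isGreatest_lagrangePoly_patE k).csSup_eq
  refine ⟨?_, fun k => ?_, hmu⟩
  · simpa [mu] using hmu 0
  · rw [hmu k, hmu (k + 1), mu]
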